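/- Let μ, ν ∈ P₁((0,∞)) with μ ≤_c ν, and let C : P₁((0,∞)) → [0,∞] be Borel measurable, where P₁((0,∞)) carries the topology of weak convergence of probability measures. Define S*(C)(ρ) := b(ρ) · C(S(ρ)) for ρ ∈ P₁((0,∞)). Then (1/b(μ)) · inf{ ∫ S*(C)(π_{x₀}) dμ(x₀) : π ∈ M(μ,ν) } = inf{ ∫ C(π̂_{y₀}) dS(μ)(y₀) : π̂ ∈ M(S(μ),S(ν)) }, where π_{x₀} and π̂_{y₀} denote disintegrations over the first marginal; moreover, π ∈ M(μ,ν) attains the infimum on the left-hand side if and only if S(π) attains the infimum on the right-hand side. -/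

import Mathlib

open MeasureTheory Set

/-- Barycenter of a measure on `ℝ`. -/
noncomputable def bary (mu : Measure ℝ) : ℝ := ∫ x, x ∂mu

/-- `mu ∈ P₁((0,∞))`: Borel probability measure on `ℝ` concentrated on `(0,∞)`
with finite first moment. -/
def MemP1 (mu : Measure ℝ) : Prop :=
  IsProbabilityMeasure mu ∧ mu (Set.Ioi (0:ℝ))ᶜ = 0 ∧ Integrable id mu

/-- Change-of-numeraire transform of a measure on `ℝ`:
`S(mu)(B) = (1/b(mu)) ∫ x · 1_B(1/x) dmu(x)`. -/
noncomputable def S (mu : Measure ℝ) : Measure ℝ :=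
  (ENNReal.ofReal (bary mu))⁻¹ •
    ((mu.withDensity fun x => ENNReal.ofReal x).map fun x => x⁻¹)

/-- Change-of-numeraire transform of a measure on `ℝ × ℝ`:
`S(π)(B) = (∫ x₁ · 1_B(1/x₀,1/x₁) dπ) / (∫ x₁ dπ)`. -/
noncomputable def S2 (pi : Measure (ℝ × ℝ)) : Measure (ℝ × ℝ) :=
  (ENNReal.ofReal (∫ p, p.2 ∂pi))⁻¹ •
    ((pi.withDensity fun p => ENNReal.ofReal p.2).map fun p => (p.1⁻¹, p.2⁻¹))

/-- `π ∈ M(μ,ν)`: martingale coupling of `μ` and `ν`, i.e. a probability measure on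
`(0,∞)²` with first marginal `μ`, second marginal `ν`, such that
`∫ f(x₀)(x₁ - x₀) dπ = 0` for all bounded Borel `f`. -/
def IsMC (mu nu : Measure ℝ) (pi : Measure (ℝ × ℝ)) : Prop :=
  IsProbabilityMeasure pi ∧
  pi ((Set.Ioi (0:ℝ) ×ˢ Set.Ioi (0:ℝ))ᶜ) = 0 ∧
  pi.map Prod.fst = mu ∧ pi.map Prod.snd = nu ∧
  ∀ f : ℝ → ℝ, Measurable f → (∃ M, ∀ x, |f x| ≤ M) →
    ∫ p, f p.1 * (p.2 - p.1) ∂pi = 0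

open scoped Classical in
/-- Disintegration (conditional kernel) of a measure on a product space with respect to the
first coordinate; equal to `Measure.condKernel` for finite measures. -/
noncomputable def disint {α β : Type*} [MeasurableSpace α] [MeasurableSpace β]
    [StandardBorelSpace β] [Nonempty β] (rho : Measure (α × β)) : α → Measure β :=
  if h : IsFiniteMeasure rho then (letI := h; fun a => rho.condKernel a)
  else fun _ => 0


/-- Convex order: `∫ φ dμ ≤ ∫ φ dν` for every convex `φ` for which both integrals exist. -/
def ConvexOrder (mu nu : Measure ℝ) : Prop :=
  ∀ phi : ℝ → ℝ, ConvexOn ℝ Set.univ phi → Integrable phi mu → Integrable phi nu →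
    ∫ x, phi x ∂mu ≤ ∫ x, phi x ∂nu

/-- Total cost `∫ S*(C)(π_{x₀}) dμ(x₀)` with `S*(C)(ρ) = b(ρ) · C(S(ρ))`. -/
noncomputable def wCostL (C : Measure ℝ → ENNReal) (mu : Measure ℝ)
    (pi : Measure (ℝ × ℝ)) : ENNReal :=
  ∫⁻ x0, ENNReal.ofReal (bary (disint pi x0)) * C (S (disint pi x0)) ∂mu

/-- Total cost `∫ C(π̂_{y₀}) dS(μ)(y₀)`. -/
noncomputable def wCostR (C : Measure ℝ → ENNReal) (Smu : Measure ℝ)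
    (rho : Measure (ℝ × ℝ)) : ENNReal :=
  ∫⁻ y0, C (disint rho y0) ∂Smu

theorem MemP1.ae_pos {mu : Measure ℝ} (h : MemP1 mu) : ∀ᵐ x ∂mu, 0 < x :=
  measure_eq_zero_iff_ae_notMem.1 h.2.1 |>.mono fun _ hx => by simpa using hx

theorem MemP1.bary_pos {mu : Measure ℝ} (h : MemP1 mu) : 0 < bary mu := by
  have := h.1
  have h0 : 0 ≤ᵐ[mu] (id : ℝ → ℝ) := h.ae_pos.mono fun _ hx => hx.le
  refine (integral_pos_iff_support_of_nonneg_ae h0 h.2.2).2 ?_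
  rw [pos_iff_ne_zero]
  intro hs
  have hs' := measure_eq_zero_iff_ae_notMem.1 hs
  obtain ⟨x, hx, hx'⟩ := (h.ae_pos.and hs').exists
  exact hx' (by simpa using hx.ne')

theorem MemP1.lintegral_ofReal {mu : Measure ℝ} (h : MemP1 mu) :
    ∫⁻ x, ENNReal.ofReal x ∂mu = ENNReal.ofReal (bary mu) :=
  (ofReal_integral_eq_lintegral_ofReal h.2.2 (h.ae_pos.mono fun _ hx => hx.le)).symm

theorem lintegral_map_withDensity {α β : Type*} [MeasurableSpace α] [MeasurableSpace β]
    (m : Measure α) {d : α → ENNReal} (hd : Measurable d) {g : α → β} (hg : Measurable g)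
    {f : β → ENNReal} (hf : Measurable f) :
    ∫⁻ y, f y ∂((m.withDensity d).map g) = ∫⁻ x, d x * f (g x) ∂m := by
  rw [lintegral_map hf hg]
  exact lintegral_withDensity_eq_lintegral_mul _ hd (hf.comp hg)

theorem lintegral_S (mu : Measure ℝ) {f : ℝ → ENNReal} (hf : Measurable f) :
    ∫⁻ y, f y ∂(S mu)
      = (ENNReal.ofReal (bary mu))⁻¹ * ∫⁻ x, ENNReal.ofReal x * f x⁻¹ ∂mu := by
  rw [S, lintegral_smul_measure,
    lintegral_map_withDensity _ ENNReal.measurable_ofReal measurable_inv hf, smul_eq_mul]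

theorem lintegral_S2 (pi : Measure (ℝ × ℝ)) {f : ℝ × ℝ → ENNReal} (hf : Measurable f) :
    ∫⁻ y, f y ∂(S2 pi)
      = (ENNReal.ofReal (∫ p, p.2 ∂pi))⁻¹
        * ∫⁻ p, ENNReal.ofReal p.2 * f (p.1⁻¹, p.2⁻¹) ∂pi := by
  rw [S2, lintegral_smul_measure,
    lintegral_map_withDensity _ (by fun_prop) (by fun_prop) hf, smul_eq_mul]

theorem ae_S_pos (mu : Measure ℝ) : ∀ᵐ y ∂(S mu), 0 < y := by
  refine Measure.ae_smul_measure ?_ _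
  rw [ae_map_iff measurable_inv.aemeasurable measurableSet_Ioi,
    ae_withDensity_iff ENNReal.measurable_ofReal]
  exact Filter.Eventually.of_forall fun x hx => by simpa using hx

theorem MemP1.S {mu : Measure ℝ} (h : MemP1 mu) : MemP1 (S mu) := by
  have := h.1
  have hb : ENNReal.ofReal (bary mu) ≠ 0 := by simpa using h.bary_pos
  refine ⟨⟨?_⟩, ?_, ?_, ?_⟩
  · rw [← lintegral_one, lintegral_S mu measurable_const]
    simp only [mul_one]
    rw [h.lintegral_ofReal, ENNReal.inv_mul_cancel hb ENNReal.ofReal_ne_top]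
  · exact measure_eq_zero_iff_ae_notMem.2 ((ae_S_pos mu).mono fun _ hx => by simpa using hx)
  · exact measurable_id.aestronglyMeasurable
  · rw [HasFiniteIntegral, lintegral_S mu (by fun_prop)]
    have : ∫⁻ x, ENNReal.ofReal x * ‖id x⁻¹‖ₑ ∂mu = ∫⁻ _, 1 ∂mu := by
      refine lintegral_congr_ae (h.ae_pos.mono fun x hx => ?_)
      simp only [id]
      rw [Real.enorm_of_nonneg (inv_pos.2 hx).le, ← ENNReal.ofReal_mul hx.le,
        mul_inv_cancel₀ hx.ne', ENNReal.ofReal_one]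
    rw [this]
    simpa using h.bary_pos

theorem MemP1.ofReal_bary_S {mu : Measure ℝ} (h : MemP1 mu) :
    ENNReal.ofReal (bary (_root_.S mu)) = (ENNReal.ofReal (bary mu))⁻¹ := by
  have := h.1
  rw [← h.S.lintegral_ofReal, lintegral_S mu ENNReal.measurable_ofReal]
  have : ∫⁻ x, ENNReal.ofReal x * ENNReal.ofReal x⁻¹ ∂mu = ∫⁻ _, 1 ∂mu := by
    refine lintegral_congr_ae (h.ae_pos.mono fun x hx => ?_)
    simp only
    rw [← ENNReal.ofReal_mul hx.le, mul_inv_cancel₀ hx.ne', ENNReal.ofReal_one]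
  rw [this]
  simp

theorem MemP1.S_S {mu : Measure ℝ} (h : MemP1 mu) : _root_.S (_root_.S mu) = mu := by
  have hb : ENNReal.ofReal (bary mu) ≠ 0 := by simpa using h.bary_pos
  refine Measure.ext_of_lintegral _ fun f hf => ?_
  rw [lintegral_S _ hf, lintegral_S _ (by fun_prop), h.ofReal_bary_S, inv_inv, ← mul_assoc,
    ENNReal.mul_inv_cancel hb ENNReal.ofReal_ne_top, one_mul]
  refine lintegral_congr_ae (h.ae_pos.mono fun x hx => ?_)
  simp only [inv_inv]
  rw [← mul_assoc, ← ENNReal.ofReal_mul hx.le, mul_inv_cancel₀ hx.ne', ENNReal.ofReal_one,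
    one_mul]

theorem IsMC.ae_pos {mu nu : Measure ℝ} {pi : Measure (ℝ × ℝ)} (h : IsMC mu nu pi) :
    ∀ᵐ p ∂pi, 0 < p.1 ∧ 0 < p.2 :=
  measure_eq_zero_iff_ae_notMem.1 h.2.1 |>.mono fun _ hx => by simpa using hx

theorem integrable_fst_of_map {mu : Measure ℝ} {pi : Measure (ℝ × ℝ)} (hmu : MemP1 mu)
    (h : pi.map Prod.fst = mu) : Integrable (fun p : ℝ × ℝ => p.1) pi := by
  subst h
  exact hmu.2.2.comp_measurable measurable_fst

theorem integrable_snd_of_map {nu : Measure ℝ} {pi : Measure (ℝ × ℝ)} (hnu : MemP1 nu)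
    (h : pi.map Prod.snd = nu) : Integrable (fun p : ℝ × ℝ => p.2) pi := by
  subst h
  exact hnu.2.2.comp_measurable measurable_snd

/-- The martingale property tested against nonnegative functions of the first coordinate. -/
theorem IsMC.lintegral_mul {mu nu : Measure ℝ} {pi : Measure (ℝ × ℝ)} (hmu : MemP1 mu)
    (hnu : MemP1 nu) (h : IsMC mu nu pi) {g : ℝ → ENNReal} (hg : Measurable g) :
    ∫⁻ p, ENNReal.ofReal p.2 * g p.1 ∂pi = ∫⁻ p, ENNReal.ofReal p.1 * g p.1 ∂pi := by
  have h1 := integrable_fst_of_map hmu h.2.2.1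
  have h2 := integrable_snd_of_map hnu h.2.2.2.1
  have key : (pi.withDensity fun p => ENNReal.ofReal p.2).map Prod.fst
      = (pi.withDensity fun p => ENNReal.ofReal p.1).map Prod.fst := by
    ext B hB
    have hB' : MeasurableSet (Prod.fst ⁻¹' B : Set (ℝ × ℝ)) := measurable_fst hB
    rw [Measure.map_apply measurable_fst hB, Measure.map_apply measurable_fst hB,
      withDensity_apply _ hB', withDensity_apply _ hB',
      ← ofReal_integral_eq_lintegral_ofReal h2.integrableOn
        (ae_restrict_of_ae (h.ae_pos.mono fun p hp => hp.2.le)),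
      ← ofReal_integral_eq_lintegral_ofReal h1.integrableOn
        (ae_restrict_of_ae (h.ae_pos.mono fun p hp => hp.1.le))]
    congr 1
    rw [← sub_eq_zero, ← integral_sub h2.integrableOn h1.integrableOn, ← integral_indicator hB',
      ← h.2.2.2.2 (B.indicator 1) (measurable_one.indicator hB)
        ⟨1, fun x => by by_cases hx : x ∈ B <;> simp [hx]⟩]
    congr with p
    by_cases hp : p.1 ∈ B <;> simp [hp]
  have := congrArg (fun m => ∫⁻ x, g x ∂m) key
  rwa [lintegral_map_withDensity _ (by fun_prop) measurable_fst hg,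
    lintegral_map_withDensity _ (by fun_prop) measurable_fst hg] at this

theorem IsMC.of_lintegral_mul {mu nu : Measure ℝ} {pi : Measure (ℝ × ℝ)} (hmu : MemP1 mu)
    (hnu : MemP1 nu) (hpos : ∀ᵐ p ∂pi, 0 < p.1 ∧ 0 < p.2) (hfst : pi.map Prod.fst = mu)
    (hsnd : pi.map Prod.snd = nu)
    (h : ∀ g : ℝ → ENNReal, Measurable g →
      ∫⁻ p, ENNReal.ofReal p.2 * g p.1 ∂pi = ∫⁻ p, ENNReal.ofReal p.1 * g p.1 ∂pi) :
    IsMC mu nu pi := by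
  have h1 := integrable_fst_of_map hmu hfst
  have h2 := integrable_snd_of_map hnu hsnd
  refine ⟨?_, measure_eq_zero_iff_ae_notMem.2 (hpos.mono fun p hp => by simpa using hp), hfst,
    hsnd, fun f hf ⟨M, hM⟩ => ?_⟩
  · have := hmu.1
    rw [← hfst] at this
    exact Measure.isProbabilityMeasure_of_map Prod.fst
  · have key : (pi.withDensity fun p => ENNReal.ofReal p.2).map Prod.fst
        = (pi.withDensity fun p => ENNReal.ofReal p.1).map Prod.fst := by
      refine Measure.ext_of_lintegral _ fun g hg => ?_
      rw [lintegral_map_withDensity _ (by fun_prop) measurable_fst hg,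
        lintegral_map_withDensity _ (by fun_prop) measurable_fst hg]
      exact h g hg
    have := congrArg (fun m => ∫ x, f x ∂m) key
    rw [integral_map measurable_fst.aemeasurable hf.aestronglyMeasurable,
      integral_map measurable_fst.aemeasurable hf.aestronglyMeasurable,
      integral_withDensity_eq_integral_toReal_smul (by fun_prop) (by simp),
      integral_withDensity_eq_integral_toReal_smul (by fun_prop) (by simp)] at this
    have hfm : AEStronglyMeasurable (fun p : ℝ × ℝ => f p.1) pi :=
      (hf.comp measurable_fst).aestronglyMeasurable
    have hfb : ∀ᵐ p : ℝ × ℝ ∂pi, ‖f p.1‖ ≤ M := Filter.Eventually.of_forall fun p => hM p.1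
    simp only [mul_sub]
    rw [integral_sub (h2.bdd_mul hfm hfb) (h1.bdd_mul hfm hfb), sub_eq_zero]
    refine Eq.trans (integral_congr_ae ?_) (this.trans (integral_congr_ae ?_))
    · exact hpos.mono fun p hp => by simp [ENNReal.toReal_ofReal hp.2.le, mul_comm]
    · exact hpos.mono fun p hp => by simp [ENNReal.toReal_ofReal hp.1.le, mul_comm]

theorem IsMC.integral_snd {mu nu : Measure ℝ} {pi : Measure (ℝ × ℝ)} (h : IsMC mu nu pi) :
    ∫ p, p.2 ∂pi = bary nu := by
  rw [bary, ← h.2.2.2.1, integral_map (f := fun x => x) measurable_snd.aemeasurable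
    measurable_id.aestronglyMeasurable]

theorem IsMC.bary_eq {mu nu : Measure ℝ} {pi : Measure (ℝ × ℝ)} (hmu : MemP1 mu)
    (hnu : MemP1 nu) (h : IsMC mu nu pi) : bary nu = bary mu := by
  have h1 := integrable_fst_of_map hmu h.2.2.1
  have h2 := integrable_snd_of_map hnu h.2.2.2.1
  have := h.2.2.2.2 1 measurable_one ⟨1, by simp⟩
  simp only [Pi.one_apply, one_mul] at this
  rw [integral_sub h2 h1, h.integral_snd, sub_eq_zero] at this
  rw [this, bary, ← h.2.2.1, integral_map (f := fun x => x) measurable_fst.aemeasurable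
    measurable_id.aestronglyMeasurable]

theorem IsMC.S2 {mu nu : Measure ℝ} {pi : Measure (ℝ × ℝ)} (hmu : MemP1 mu)
    (hnu : MemP1 nu) (h : IsMC mu nu pi) : IsMC (S mu) (S nu) (S2 pi) := by
  refine .of_lintegral_mul hmu.S hnu.S ?_ ?_ ?_ fun g hg => ?_
  · refine Measure.ae_smul_measure ?_ _
    refine (ae_map_iff (by fun_prop) (measurableSet_Ioi.prod measurableSet_Ioi)).2 ?_
    rw [ae_withDensity_iff (by fun_prop)]
    exact h.ae_pos.mono fun p hp _ => ⟨inv_pos.2 hp.1, inv_pos.2 hp.2⟩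
  · refine Measure.ext_of_lintegral _ fun f hf => ?_
    rw [lintegral_map hf measurable_fst, lintegral_S2 _ (by fun_prop), lintegral_S _ hf,
      h.integral_snd, h.bary_eq hmu hnu]
    congr 1
    refine (h.lintegral_mul hmu hnu (hf.comp measurable_inv)).trans ?_
    rw [← h.2.2.1, lintegral_map (by fun_prop) measurable_fst]
    rfl
  · refine Measure.ext_of_lintegral _ fun f hf => ?_
    rw [lintegral_map hf measurable_snd, lintegral_S2 _ (by fun_prop), lintegral_S _ hf,
      h.integral_snd]
    congr 1
    rw [← h.2.2.2.1]
    rw [lintegral_map (by fun_prop) measurable_snd]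
  · rw [lintegral_S2 _ (by fun_prop), lintegral_S2 _ (by fun_prop)]
    congr 1
    have h1 := h.lintegral_mul hmu hnu
      (g := fun x => ENNReal.ofReal x⁻¹ * g x⁻¹) (by fun_prop)
    rw [h1]
    refine lintegral_congr_ae (h.ae_pos.mono fun p hp => ?_)
    simp only
    rw [← mul_assoc, ← mul_assoc, ← ENNReal.ofReal_mul hp.1.le, ← ENNReal.ofReal_mul hp.2.le,
      mul_inv_cancel₀ hp.1.ne', mul_inv_cancel₀ hp.2.ne']

theorem IsMC.S2_S2 {mu nu : Measure ℝ} {pi : Measure (ℝ × ℝ)} (hmu : MemP1 mu)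
    (hnu : MemP1 nu) (h : IsMC mu nu pi) : _root_.S2 (_root_.S2 pi) = pi := by
  have hb : ENNReal.ofReal (bary nu) ≠ 0 := by simpa using hnu.bary_pos
  refine Measure.ext_of_lintegral _ fun f hf => ?_
  rw [lintegral_S2 _ hf, lintegral_S2 _ (by fun_prop), (h.S2 hmu hnu).integral_snd,
    h.integral_snd, hnu.ofReal_bary_S, inv_inv, ← mul_assoc,
    ENNReal.mul_inv_cancel hb ENNReal.ofReal_ne_top, one_mul]
  refine lintegral_congr_ae (h.ae_pos.mono fun p hp => ?_)
  simp only [inv_inv]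
  rw [← mul_assoc, ← ENNReal.ofReal_mul hp.2.le, mul_inv_cancel₀ hp.2.ne', ENNReal.ofReal_one,
    one_mul]

open ProbabilityTheory

theorem disint_eq_condKernel (pi : Measure (ℝ × ℝ)) [h : IsFiniteMeasure pi] :
    disint pi = pi.condKernel := by
  funext x
  simp [disint, h]

/-- The kernels of a martingale coupling have barycenter equal to their base point. -/
theorem IsMC.ae_condKernel {mu nu : Measure ℝ} {pi : Measure (ℝ × ℝ)} [IsFiniteMeasure pi]
    (hmu : MemP1 mu) (hnu : MemP1 nu) (h : IsMC mu nu pi) :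
    ∀ᵐ x ∂mu, 0 < x ∧ ∫⁻ z, ENNReal.ofReal z ∂(pi.condKernel x) = ENNReal.ofReal x ∧
      bary (pi.condKernel x) = x := by
  have := hmu.1
  have hfst : pi.fst = mu := h.2.2.1
  have hpos : ∀ᵐ x ∂mu, ∀ᵐ z ∂(pi.condKernel x), 0 < x ∧ 0 < z := by
    have := h.ae_pos
    rw [← pi.disintegrate pi.condKernel] at this
    have := Measure.ae_ae_of_ae_compProd this
    rwa [hfst] at this
  have hmean : (fun x => ∫⁻ z, ENNReal.ofReal z ∂(pi.condKernel x))
      =ᵐ[mu] fun x => ENNReal.ofReal x := by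
    refine ae_eq_of_forall_setLIntegral_eq_of_sigmaFinite
      (ENNReal.measurable_ofReal.lintegral_kernel) ENNReal.measurable_ofReal fun B hB _ => ?_
    have hg : Measurable (B.indicator (1 : ℝ → ENNReal)) := measurable_one.indicator hB
    have h1 := h.lintegral_mul hmu hnu hg
    rw [← Measure.lintegral_condKernel (ρ := pi)
        (f := fun p => ENNReal.ofReal p.2 * B.indicator 1 p.1) (by fun_prop), hfst] at h1
    rw [← lintegral_map (f := fun x => ENNReal.ofReal x * B.indicator 1 x) (by fun_prop)
      measurable_fst, h.2.2.1] at h1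
    rw [← lintegral_indicator hB, ← lintegral_indicator hB]
    refine Eq.trans (lintegral_congr fun x => ?_) (h1.trans (lintegral_congr fun x => ?_))
    · by_cases hx : x ∈ B <;> simp [hx]
    · by_cases hx : x ∈ B <;> simp [hx]
  filter_upwards [hmu.ae_pos, hpos, hmean] with x hx hz hm
  refine ⟨hx, hm, ?_⟩
  rw [bary, integral_eq_lintegral_of_nonneg_ae (hz.mono fun z hz => hz.2.le)
    measurable_id.aestronglyMeasurable, hm, ENNReal.toReal_ofReal hx.le]

/-- The unnormalised kernel `y ↦ S (κ y⁻¹)` when `κ x` has barycenter `x`. -/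
noncomputable def numeraireKernel (κ : Kernel ℝ ℝ) [IsSFiniteKernel κ] : Kernel ℝ ℝ :=
  ((κ.comap (fun y : ℝ => y⁻¹) measurable_inv).withDensity
    fun y z => ENNReal.ofReal y * ENNReal.ofReal z).map fun z => z⁻¹

theorem lintegral_numeraireKernel (κ : Kernel ℝ ℝ) [IsSFiniteKernel κ] (y : ℝ)
    {f : ℝ → ENNReal} (hf : Measurable f) :
    ∫⁻ z, f z ∂(numeraireKernel κ y)
      = ENNReal.ofReal y * ∫⁻ z, ENNReal.ofReal z * f z⁻¹ ∂(κ y⁻¹) := by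
  rw [numeraireKernel, Kernel.lintegral_map _ measurable_inv _ hf,
    Kernel.lintegral_withDensity _ (by fun_prop) _ (g := fun z => f z⁻¹) (by fun_prop),
    Kernel.comap_apply, ← lintegral_const_mul _ (by fun_prop)]
  simp only [mul_assoc]

theorem numeraireKernel_inv_eq_S {κ : Kernel ℝ ℝ} [IsSFiniteKernel κ] {x : ℝ} (hx : 0 < x)
    (hb : bary (κ x) = x) : numeraireKernel κ x⁻¹ = S (κ x) := by
  refine Measure.ext_of_lintegral _ fun f hf => ?_
  rw [lintegral_numeraireKernel _ _ hf, lintegral_S _ hf, hb, inv_inv,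
    ENNReal.ofReal_inv_of_pos hx]

theorem IsMC.exists_kernel {mu nu : Measure ℝ} {pi : Measure (ℝ × ℝ)} [IsFiniteMeasure pi]
    [IsFiniteMeasure (_root_.S2 pi)]
    (hmu : MemP1 mu) (hnu : MemP1 nu) (h : IsMC mu nu pi) :
    ∃ η : Kernel ℝ ℝ, (∀ᵐ x ∂mu, η x⁻¹ = _root_.S (pi.condKernel x)) ∧
      ∀ᵐ y ∂(_root_.S mu), η y = (_root_.S2 pi).condKernel y := by
  classical
  set η₀ := numeraireKernel pi.condKernel with hη₀
  have hG : MeasurableSet {y | η₀ y Set.univ = 1} :=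
    η₀.measurable_coe MeasurableSet.univ (measurableSet_singleton 1)
  set η := Kernel.piecewise hG η₀ (Kernel.const ℝ (Measure.dirac (1 : ℝ))) with hη
  have hη' : ∀ y, η₀ y Set.univ = 1 → η y = η₀ y := fun y hy => by
    rw [hη, Kernel.piecewise_apply]
    exact if_pos hy
  have : IsMarkovKernel η := by
    refine ⟨fun y => ⟨?_⟩⟩
    rw [hη, Kernel.piecewise_apply]
    split_ifs with hy
    · exact hy
    · simp
  have hae : ∀ᵐ x ∂mu, 0 < x ∧ η x⁻¹ = η₀ x⁻¹ ∧ η₀ x⁻¹ = _root_.S (pi.condKernel x) := by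
    filter_upwards [h.ae_condKernel hmu hnu] with x ⟨hx, hm, hb⟩
    refine ⟨hx, hη' _ ?_, numeraireKernel_inv_eq_S hx hb⟩
    rw [← lintegral_one, hη₀, lintegral_numeraireKernel _ _ measurable_const]
    simp only [mul_one, inv_inv]
    rw [hm, ← ENNReal.ofReal_mul (inv_pos.2 hx).le, inv_mul_cancel₀ hx.ne', ENNReal.ofReal_one]
  have hfst : (_root_.S2 pi).fst = _root_.S mu := (h.S2 hmu hnu).2.2.1
  have := hmu.S.1
  refine ⟨η, hae.mono fun x hx => hx.2.1.trans hx.2.2, ?_⟩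
  rw [← hfst]
  refine eq_condKernel_of_measure_eq_compProd η ?_
  refine Measure.ext_of_lintegral _ fun f hf => ?_
  rw [hfst, Measure.lintegral_compProd hf, lintegral_S _ (by fun_prop), lintegral_S2 _ hf,
    h.integral_snd, h.bary_eq hmu hnu, ← Measure.lintegral_condKernel (ρ := pi) (by fun_prop),
    show pi.fst = mu from h.2.2.1]
  congr 1
  refine lintegral_congr_ae (hae.mono fun x ⟨hx, h1, _⟩ => ?_)
  simp only
  rw [h1, hη₀, lintegral_numeraireKernel _ _ (by fun_prop), inv_inv, ← mul_assoc,
    ← ENNReal.ofReal_mul hx.le, mul_inv_cancel₀ hx.ne', ENNReal.ofReal_one, one_mul]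

theorem IsMC.wCostR_S2 {mu nu : Measure ℝ} {pi : Measure (ℝ × ℝ)}
    (hmu : MemP1 mu) (hnu : MemP1 nu) (h : IsMC mu nu pi)
    {C : Measure ℝ → ENNReal} (hC : Measurable C) :
    wCostR C (_root_.S mu) (_root_.S2 pi)
      = (ENNReal.ofReal (bary mu))⁻¹ * wCostL C mu pi := by
  have := h.1
  have := (h.S2 hmu hnu).1
  obtain ⟨η, h1, h2⟩ := h.exists_kernel hmu hnu
  rw [wCostR, wCostL, disint_eq_condKernel, disint_eq_condKernel,
    ← lintegral_congr_ae (h2.mono fun y hy => congrArg C hy),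
    lintegral_S _ (f := fun y => C (η y)) (hC.comp η.measurable)]
  congr 1
  refine lintegral_congr_ae ?_
  filter_upwards [h1, h.ae_condKernel hmu hnu] with x hx hx'
  rw [hx, hx'.2.2]

/-- change of numeraire for weak martingale optimal transport. -/
theorem stmt9 (mu nu : Measure ℝ) (hmu : MemP1 mu) (hnu : MemP1 nu)
    (hcvx : ConvexOrder mu nu)
    (C : Measure ℝ → ENNReal) (hC : Measurable C) :
    (ENNReal.ofReal (bary mu))⁻¹ *
        sInf {r | ∃ pi, IsMC mu nu pi ∧ r = wCostL C mu pi}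
      = sInf {r | ∃ rho, IsMC (S mu) (S nu) rho ∧ r = wCostR C (S mu) rho} ∧
    ∀ pi, IsMC mu nu pi →
      ((wCostL C mu pi = sInf {r | ∃ pi', IsMC mu nu pi' ∧ r = wCostL C mu pi'}) ↔
       (wCostR C (S mu) (S2 pi)
          = sInf {r | ∃ rho, IsMC (S mu) (S nu) rho ∧ r = wCostR C (S mu) rho})) := by
  have hb : ENNReal.ofReal (bary mu) ≠ 0 := by simpa using hmu.bary_pos
  have hb0 : (ENNReal.ofReal (bary mu))⁻¹ ≠ 0 := ENNReal.inv_ne_zero.2 ENNReal.ofReal_ne_top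
  have hbt : (ENNReal.ofReal (bary mu))⁻¹ ≠ ⊤ := ENNReal.inv_ne_top.2 hb
  have hset : {r | ∃ rho, IsMC (S mu) (S nu) rho ∧ r = wCostR C (S mu) rho}
      = (fun r => (ENNReal.ofReal (bary mu))⁻¹ * r) ''
        {r | ∃ pi, IsMC mu nu pi ∧ r = wCostL C mu pi} := by
    ext r
    constructor
    · rintro ⟨rho, hrho, rfl⟩
      have hpi := hrho.S2 hmu.S hnu.S
      rw [hmu.S_S, hnu.S_S] at hpi
      refine ⟨_, ⟨_, hpi, rfl⟩, ?_⟩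
      simp only
      rw [← hpi.wCostR_S2 hmu hnu hC, hrho.S2_S2 hmu.S hnu.S]
    · rintro ⟨_, ⟨pi, hpi, rfl⟩, rfl⟩
      exact ⟨_, hpi.S2 hmu hnu, (hpi.wCostR_S2 hmu hnu hC).symm⟩
  have hinf : (ENNReal.ofReal (bary mu))⁻¹ *
        sInf {r | ∃ pi, IsMC mu nu pi ∧ r = wCostL C mu pi}
      = sInf {r | ∃ rho, IsMC (S mu) (S nu) rho ∧ r = wCostR C (S mu) rho} := by
    rw [hset, sInf_image, sInf_eq_iInf, ENNReal.mul_iInf_of_ne hb0 hbt]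
    exact iInf_congr fun r => ENNReal.mul_iInf_of_ne hb0 hbt
  refine ⟨hinf, fun pi hpi => ?_⟩
  rw [← hinf, hpi.wCostR_S2 hmu hnu hC, ENNReal.mul_right_inj hb0 hbt]
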